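/- Let G be a k-extendible graph with k ≥ 2. Then for every edge uv of G, the graph G - {u,v} obtained by deleting the two endpoints u and v (and all incident edges) is connected. -/

import Mathlib

/-- A graph `G` is `k`-extendible if it has at least `2k+2` vertices, is connected,
has a perfect matching, and every matching of size `k` extends to a perfect matching. -/
def SimpleGraph.IsKExtendible {V : Type*} (G : SimpleGraph V) (k : ℕ) : Prop :=
  2 * k + 2 ≤ Nat.card V ∧ G.Connected ∧
    (∃ P : G.Subgraph, P.IsPerfectMatching) ∧
    ∀ M : G.Subgraph, M.IsMatching → M.edgeSet.ncard = k →
      ∃ P : G.Subgraph, P.IsPerfectMatching ∧ M ≤ P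

open Classical in
/-- Functional form of extendibility. -/
def FExt {V : Type*} [Fintype V] (G : SimpleGraph V) (j : ℕ) : Prop :=
  ∀ f : V → V, (∀ x, f (f x) = x) → (∀ x, f x ≠ x → G.Adj x (f x)) →
    (Finset.univ.filter (fun x => f x ≠ x)).card = 2 * j →
    ∃ g : V → V, (∀ x, g (g x) = x) ∧ (∀ x, G.Adj x (g x)) ∧ ∀ x, f x ≠ x → g x = f x

theorem exists_fun_of_perfect {V : Type*} (G : SimpleGraph V) (P : G.Subgraph)
    (hP : P.IsPerfectMatching) :
    ∃ g : V → V, (∀ x, g (g x) = x) ∧ (∀ x, G.Adj x (g x)) ∧ ∀ x y, P.Adj x y → g x = y := by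
  rw [SimpleGraph.Subgraph.isPerfectMatching_iff] at hP
  choose g hg hu using hP
  refine ⟨g, fun x => ?_, fun x => (hg x).adj_sub, fun x y h => (hu x y h).symm⟩
  exact (hu (g x) x (hg x).symm).symm

open Classical in
theorem fext_of_ext {V : Type*} [Fintype V] (G : SimpleGraph V) (k : ℕ)
    (h : G.IsKExtendible k) : FExt G k := by
  intro f hf hadj hc
  let M : G.Subgraph :=
    { verts := {x | f x ≠ x}
      Adj := fun x y => f x = y ∧ x ≠ y
      adj_sub := by
        rintro x y ⟨rfl, h2⟩
        exact hadj x (Ne.symm h2)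
      edge_vert := by
        rintro x y ⟨rfl, h2⟩
        exact Ne.symm h2
      symm := by
        constructor
        rintro x y ⟨rfl, h2⟩
        exact ⟨hf x, h2.symm⟩ }
  have hM : M.IsMatching := by
    intro x hx
    exact ⟨f x, ⟨rfl, Ne.symm hx⟩, fun y hy => hy.1.symm⟩
  have hcard : M.edgeSet.ncard = k := by
    have h1 := M.spanningCoe.sum_degrees_eq_twice_card_edges
    have h2 : ∀ x, M.spanningCoe.degree x = if f x ≠ x then 1 else 0 := by
      intro x
      rw [← SimpleGraph.card_neighborFinset_eq_degree]
      split_ifs with hx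
      · rw [Finset.card_eq_one]
        refine ⟨f x, ?_⟩
        ext y
        simp only [SimpleGraph.mem_neighborFinset, Finset.mem_singleton]
        change (f x = y ∧ x ≠ y) ↔ _
        grind
      · rw [Finset.card_eq_zero]
        ext y
        simp only [SimpleGraph.mem_neighborFinset]
        change (f x = y ∧ x ≠ y) ↔ _
        grind
    simp only [h2] at h1
    rw [← Finset.card_filter, hc] at h1
    have h3 : M.edgeSet = (M.spanningCoe.edgeFinset : Set (Sym2 V)) := by
      simp
    rw [h3, Set.ncard_coe_finset]
    omega
  obtain ⟨P, hP, hle⟩ := h.2.2.2 M hM hcard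
  obtain ⟨g, h1, h2, h3⟩ := exists_fun_of_perfect G P hP
  exact ⟨g, h1, h2, fun x hx => h3 _ _ (hle.2 ⟨rfl, Ne.symm hx⟩)⟩

open Classical in
theorem fext_step {V : Type*} [Fintype V] (G : SimpleGraph V) (j : ℕ)
    (hn : 2 * j + 4 ≤ Fintype.card V) (p : V → V) (hp : ∀ x, p (p x) = x)
    (hpa : ∀ x, G.Adj x (p x)) (h : FExt G (j + 1)) : FExt G j := by
  intro f
  induction hm : (Finset.univ.filter (fun x => f x ≠ x ∧ f x ≠ p x)).card
    using Nat.strong_induction_on generalizing f with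
  | _ m ih =>
  intro hf hadj hc
  by_cases hI : ∃ x y, f x = x ∧ f y = y ∧ G.Adj x y
  · obtain ⟨x, y, hx, hy, hxy⟩ := hI
    have hne := hxy.ne
    have hyx := hxy.symm
    obtain ⟨g, h1, h2, h3⟩ := h (fun w => if w = x then y else if w = y then x else f w)
      (by grind) (by grind) (by
        have : (Finset.univ.filter (fun w =>
            (if w = x then y else if w = y then x else f w) ≠ w)) =
            insert x (insert y (Finset.univ.filter (fun x => f x ≠ x))) := by
          ext w
          simp only [Finset.mem_filter, Finset.mem_univ, true_and, Finset.mem_insert]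
          grind
        rw [this, Finset.card_insert_of_notMem (by simp [hne, hx]),
          Finset.card_insert_of_notMem (by simp [hy]), hc]
        ring)
    exact ⟨g, h1, h2, by grind⟩
  · push Not at hI
    have hIc : 2 < (Finset.univ.filter (fun x => ¬ (f x ≠ x))).card := by
      have := Finset.card_filter_add_card_filter_not (s := (Finset.univ : Finset V))
        (fun x => f x ≠ x)
      rw [Finset.card_univ] at this
      omega
    obtain ⟨x, a, b, hx, ha, hb, hxa, hxb, hab⟩ := Finset.two_lt_card_iff.1 hIc
    simp only [Finset.mem_filter, Finset.mem_univ, true_and, not_not] at hx ha hb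
    obtain ⟨y, hy⟩ : ∃ y, y = p x := ⟨_, rfl⟩
    obtain ⟨z, hz⟩ : ∃ z, z = f y := ⟨_, rfl⟩
    have hxy : G.Adj x y := hy ▸ hpa x
    have hyx := hxy.symm
    have hfy : f y ≠ y := fun e => hI x y hx e hxy
    have hxne := hxy.ne
    have hzx : z ≠ x := by grind
    have hzf : f z = y := by grind
    have hpy : p y = x := by grind
    obtain ⟨f', hf'⟩ : ∃ f' : V → V, f' =
      (fun w => if w = x then y else if w = y then x else if w = z then z else f w) := ⟨_, rfl⟩
    obtain ⟨g, h1, h2, h3⟩ := ih _ (by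
        rw [← hm]
        apply Finset.card_lt_card
        rw [Finset.ssubset_iff_of_subset]
        · refine ⟨y, ?_, ?_⟩
          · simp only [Finset.mem_filter, Finset.mem_univ, true_and]
            grind
          · simp only [Finset.mem_filter, Finset.mem_univ, true_and]
            grind
        · intro w
          simp only [Finset.mem_filter, Finset.mem_univ, true_and]
          grind) f' rfl (by grind) (by grind) (by
        have : (Finset.univ.filter (fun w => f' w ≠ w)) =
            insert x ((Finset.univ.filter (fun x => f x ≠ x)).erase z) := by
          ext w
          simp only [Finset.mem_filter, Finset.mem_univ, true_and, Finset.mem_insert,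
            Finset.mem_erase]
          grind
        rw [this, Finset.card_insert_of_notMem (by simp [hx]),
          Finset.card_erase_add_one (by simp only [Finset.mem_filter, Finset.mem_univ, true_and]; grind), hc])
    exfalso
    have key : ∀ c, f c = c → x ≠ c → g c = z := by
      intro c hc hxc
      have e1 : f (g c) ≠ g c := fun e => hI c (g c) hc e (h2 c)
      have e2 : f' c = c := by grind
      have e3 : f' (g c) = g c := by
        by_contra e
        have := h3 _ e
        rw [h1] at this
        grind
      grind
    have := key a ha hxa
    have := key b hb hxb
    have := h1 a
    have := h1 b
    grind

theorem even_of_inv {V : Type*} (S : Finset V) (g : V → V) (h : ∀ x, g (g x) = x)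
    (hne : ∀ x, g x ≠ x) (hS : ∀ x ∈ S, g x ∈ S) : Even S.card := by
  have := Finset.sum_involution (s := S) (f := fun _ => (1 : ZMod 2)) (fun x _ => g x)
    (fun _ _ => by decide) (fun x _ _ => hne x) hS (fun x _ => h x)
  simpa [ZMod.natCast_eq_zero_iff_even] using this

open Classical in
theorem fext_two {V : Type*} [Fintype V] {G : SimpleGraph V} (h : FExt G 2) {u a v b : V}
    (hua : G.Adj u a) (hvb : G.Adj v b) (h1 : u ≠ v) (h2 : u ≠ b) (h3 : a ≠ v) (h4 : a ≠ b) :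
    ∃ g : V → V, (∀ x, g (g x) = x) ∧ (∀ x, G.Adj x (g x)) ∧ g u = a ∧ g v = b := by
  have := hua.ne
  have := hvb.ne
  have := hua.symm
  have := hvb.symm
  obtain ⟨g, e1, e2, e3⟩ := h (fun w => if w = u then a else if w = a then u else
    if w = v then b else if w = b then v else w) (by grind) (by grind) (by
      have : (Finset.univ.filter (fun w => (if w = u then a else if w = a then u else
          if w = v then b else if w = b then v else w) ≠ w)) = {u, a, v, b} := by
        ext w
        simp only [Finset.mem_filter, Finset.mem_univ, true_and, Finset.mem_insert,
          Finset.mem_singleton]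
        grind
      rw [this]
      grind)
  exact ⟨g, e1, e2, by grind, by grind⟩

open Classical in
theorem fext_one {V : Type*} [Fintype V] {G : SimpleGraph V} (h : FExt G 1) {u a : V}
    (hua : G.Adj u a) :
    ∃ g : V → V, (∀ x, g (g x) = x) ∧ (∀ x, G.Adj x (g x)) ∧ g u = a := by
  have := hua.ne
  have := hua.symm
  obtain ⟨g, e1, e2, e3⟩ := h (fun w => if w = u then a else if w = a then u else w)
    (by grind) (by grind) (by
      have : (Finset.univ.filter (fun w => (if w = u then a else if w = a then u else w) ≠ w))
          = {u, a} := by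
        ext w
        simp only [Finset.mem_filter, Finset.mem_univ, true_and, Finset.mem_insert,
          Finset.mem_singleton]
        grind
      rw [this]
      grind)
  exact ⟨g, e1, e2, by grind⟩

open Classical in
theorem no_cross {V : Type*} [Fintype V] {G : SimpleGraph V} (h1 : FExt G 1) (h2 : FExt G 2)
    {u v : V} (huv : G.Adj u v) (A : Finset V) (hu : u ∉ A) (hv : v ∉ A)
    (hA : ∀ x ∈ A, ∀ y, G.Adj x y → y ∈ A ∨ y = u ∨ y = v)
    {a b : V} (ha : a ∈ A) (hb : b ∉ A) (hbu : b ≠ u)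
    (hua : G.Adj u a) (hvb : G.Adj v b) : False := by
  obtain ⟨g, e1, e2, e3⟩ := fext_one h1 huv
  have p1 : Even A.card := even_of_inv A g e1 (fun x => (e2 x).ne') (by
    intro x hx
    rcases hA x hx _ (e2 x) with h | h | h <;> grind)
  obtain ⟨g, e1, e2, e3, e4⟩ := fext_two h2 hua hvb huv.ne hbu.symm
    (by grind) (by grind)
  have p2 : Even (A.erase a).card := even_of_inv _ g e1 (fun x => (e2 x).ne') (by
    intro x hx
    have hx' := Finset.mem_erase.1 hx
    rcases hA x hx'.2 _ (e2 x) with h | h | h <;> grind)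
  have := Finset.card_erase_add_one ha
  grind

theorem exists_cross {V : Type*} {G : SimpleGraph V} (hG : G.Connected) (A : Finset V) {a b : V}
    (ha : a ∈ A) (hb : b ∉ A) : ∃ x ∈ A, ∃ y, y ∉ A ∧ G.Adj x y := by
  obtain ⟨w⟩ := hG.preconnected a b
  obtain ⟨d, _, h1, h2⟩ := w.exists_boundary_dart (A : Set V) (by simpa using ha) (by simpa using hb)
  exact ⟨d.fst, by simpa using h1, d.snd, by simpa using h2, d.adj⟩

open Classical in
theorem no_sep {V : Type*} [Fintype V] {G : SimpleGraph V} (hG : G.Connected)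
    (h1 : FExt G 1) (h2 : FExt G 2)
    {u v : V} (huv : G.Adj u v) (A : Finset V) (hu : u ∉ A) (hv : v ∉ A)
    (hA : ∀ x ∈ A, ∀ y, G.Adj x y → y ∈ A ∨ y = u ∨ y = v)
    {a b : V} (ha : a ∈ A) (hb : b ∉ A) (hbu : b ≠ u) (hbv : b ≠ v) : False := by
  -- wlog-style core
  have core : ∀ u v : V, G.Adj u v → u ∉ A → v ∉ A →
      (∀ x ∈ A, ∀ y, G.Adj x y → y ∈ A ∨ y = u ∨ y = v) → b ≠ u → b ≠ v →
      ∀ a ∈ A, G.Adj u a → False := by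
    intro u v huv hu hv hA hbu hbv a ha hua
    have c1 : ∀ b, b ∉ A → b ≠ u → ¬ G.Adj v b := fun b hb hbu hvb =>
      no_cross h1 h2 huv A hu hv hA ha hb hbu hua hvb
    obtain ⟨c, hc, y, hy, hcy⟩ := exists_cross hG
      (Finset.univ.filter (fun x => x ∉ A ∧ x ≠ u ∧ x ≠ v)) (a := b) (b := u)
      (by simp [hb, hbu, hbv]) (by simp)
    simp only [Finset.mem_filter, Finset.mem_univ, true_and] at hc hy
    have huc : G.Adj u c := by
      have := hcy.symm
      have := hA y
      grind
    have c2 : ∀ a' ∈ A, ¬ G.Adj v a' := fun a' ha' hva =>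
      no_cross h1 h2 huv.symm A hv hu (fun x hx y h => by have := hA x hx y h; tauto)
        ha' hc.1 hc.2.2 hva huc
    obtain ⟨g, e1, e2, e3⟩ := fext_one h1 hua
    have := e2 v
    by_cases hgv : g v ∈ A
    · exact c2 _ hgv this
    · refine c1 _ hgv ?_ this
      grind
  obtain ⟨x, hx, y, hy, hxy⟩ := exists_cross hG A ha hb
  rcases hA x hx y hxy with h | rfl | rfl
  · exact hy h
  · exact core y v huv hu hv hA hbu hbv x hx hxy.symm
  · exact core y u huv.symm hv hu (fun x hx y h => by have := hA x hx y h; tauto)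
      hbv hbu x hx hxy.symm

/-- If `G` is `k`-extendible with `k ≥ 2`, then for every edge `uv`,
the graph `G - {u,v}` is connected. -/
theorem deleteEdgeEnds_connected {V : Type*} [Fintype V]
    (G : SimpleGraph V) (k : ℕ) (hk : 2 ≤ k) (h : G.IsKExtendible k)
    (u v : V) (huv : G.Adj u v) :
    (G.induce ({u, v}ᶜ : Set V)).Connected := by
  classical
  have hk' := fext_of_ext G k h
  obtain ⟨hn, hG, ⟨P, hP⟩, -⟩ := h
  rw [Nat.card_eq_fintype_card] at hn
  obtain ⟨p, hp, hpa, -⟩ := exists_fun_of_perfect G P hP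
  have hall : ∀ d j, j + d = k → FExt G j := by
    intro d
    induction d with
    | zero => intro j hj; simpa [← hj] using hk'
    | succ d ih =>
      intro j hj
      exact fext_step G j (by omega) p hp hpa (ih (j + 1) (by omega))
  have h1 := hall (k - 1) 1 (by omega)
  have h2 := hall (k - 2) 2 (by omega)
  have hne : ∃ x : V, x ∉ ({u, v} : Finset V) := by
    by_contra hcon
    push Not at hcon
    have := Finset.card_le_card (fun x _ => hcon x : (Finset.univ : Finset V) ⊆ {u, v})
    have := Finset.card_le_two (a := u) (b := v)
    rw [Finset.card_univ] at *
    omega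
  obtain ⟨x0, hx0⟩ := hne
  haveI : Nonempty (({u, v}ᶜ : Set V)) := ⟨⟨x0, by simpa using hx0⟩⟩
  refine ⟨?_⟩
  rintro ⟨a, ha⟩ ⟨b, hb⟩
  by_contra hab
  let A : Finset V := Finset.univ.filter (fun x => ∃ hx : x ∈ ({u, v}ᶜ : Set V),
    (G.induce ({u, v}ᶜ : Set V)).Reachable ⟨a, ha⟩ ⟨x, hx⟩)
  have hbb : b ≠ u ∧ b ≠ v := by simpa using hb
  refine no_sep hG h1 h2 huv A (by simp [A]) (by simp [A]) ?_ (a := a) (b := b) ?_ ?_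
    hbb.1 hbb.2
  · intro x hx y hxy
    by_cases hy : y ∈ ({u, v}ᶜ : Set V)
    · left
      simp only [A, Finset.mem_filter, Finset.mem_univ, true_and] at hx ⊢
      obtain ⟨hx, hr⟩ := hx
      exact ⟨hy, hr.trans (SimpleGraph.Adj.reachable (by simpa using hxy))⟩
    · right
      simpa [or_iff_not_imp_left] using hy
  · simp only [A, Finset.mem_filter, Finset.mem_univ, true_and]
    exact ⟨ha, SimpleGraph.Reachable.refl _⟩
  · simp only [A, Finset.mem_filter, Finset.mem_univ, true_and]
    rintro ⟨_, hr⟩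
    exact hab hr
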